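/- arXiv:2402.13971 — 2 statements merged into one kernel-verified Lean document; each statement's English description precedes it below -/
import Mathlib

section
/- Compatibility of elementary differentials with the derivation D (chain rule): for every C^∞ function f : ℝ → ℝ and every polynomial p ∈ ℝ[X_0, X_1, …], the function y ↦ F_f[p](y) is C^∞ and its derivative is the function y ↦ F_f[D p](y). -/
open MvPolynomial

/-- The derivation `D` with `D X_k = X_{k+1}`. -/
noncomputable def Dop (p : MvPolynomial ℕ ℝ) : MvPolynomial ℕ ℝ :=
  ∑ᶠ k : ℕ, X (k + 1) * pderiv k p

/-- The elementary differential `F_f[p](y)`: evaluate `p` at `X_k ↦ f^{(k)}(y)`. -/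
noncomputable def Ff (f : ℝ → ℝ) (p : MvPolynomial ℕ ℝ) (y : ℝ) : ℝ :=
  eval (fun k => iteratedDeriv k f y) p

theorem finite_support_Dop_summand (p : MvPolynomial ℕ ℝ) :
    (Function.support fun k : ℕ => (X (k + 1) * pderiv k p : MvPolynomial ℕ ℝ)).Finite := by
  refine p.vars.finite_toSet.subset fun k hk => ?_
  by_contra h
  exact hk (by simp [pderiv_eq_zero_of_notMem_vars h])

theorem Dop_C (a : ℝ) : Dop (C a) = 0 := by
  simp [Dop]

theorem Dop_add (p q : MvPolynomial ℕ ℝ) : Dop (p + q) = Dop p + Dop q := by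
  simp only [Dop, map_add, mul_add]
  exact finsum_add_distrib (finite_support_Dop_summand p) (finite_support_Dop_summand q)

theorem Dop_X (n : ℕ) : Dop (X n) = X (n + 1) := by
  rw [Dop, finsum_eq_single _ n]
  · simp
  · intro k hk
    simp [pderiv_X_of_ne hk.symm]

theorem Dop_mul (p q : MvPolynomial ℕ ℝ) : Dop (p * q) = Dop p * q + p * Dop q := by
  have hp := finite_support_Dop_summand p
  have hq := finite_support_Dop_summand q
  simp only [Dop]
  rw [finsum_mul' _ _ hp, mul_finsum' _ _ hq, ← finsum_add_distrib]
  · refine finsum_congr fun k => ?_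
    rw [pderiv_mul]
    ring
  · exact hp.subset fun k hk h => hk (by simp only [h, zero_mul])
  · exact hq.subset fun k hk h => hk (by simp only [h, mul_zero])

theorem Ff_C (f : ℝ → ℝ) (a : ℝ) : Ff f (C a) = fun _ => a := by
  ext y
  simp [Ff]

theorem Ff_X (f : ℝ → ℝ) (n : ℕ) : Ff f (X n) = iteratedDeriv n f := by
  ext y
  simp [Ff]

theorem Ff_add (f : ℝ → ℝ) (p q : MvPolynomial ℕ ℝ) : Ff f (p + q) = Ff f p + Ff f q := by
  ext y
  simp [Ff]

theorem Ff_mul (f : ℝ → ℝ) (p q : MvPolynomial ℕ ℝ) : Ff f (p * q) = Ff f p * Ff f q := by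
  ext y
  simp [Ff]

theorem contDiff_Ff {f : ℝ → ℝ} (hf : ContDiff ℝ (⊤ : ℕ∞) f) (p : MvPolynomial ℕ ℝ) :
    ContDiff ℝ (⊤ : ℕ∞) (Ff f p) := by
  induction p using MvPolynomial.induction_on with
  | C a =>
    rw [Ff_C]
    exact contDiff_const
  | add p q hp hq =>
    rw [Ff_add]
    exact hp.add hq
  | mul_X p n hp =>
    rw [Ff_mul, Ff_X, iteratedDeriv_eq_iterate]
    exact hp.mul (hf.iterate_deriv n)

theorem hasDerivAt_Ff {f : ℝ → ℝ} (hf : ContDiff ℝ (⊤ : ℕ∞) f) (p : MvPolynomial ℕ ℝ) (y : ℝ) :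
    HasDerivAt (Ff f p) (Ff f (Dop p) y) y := by
  induction p using MvPolynomial.induction_on with
  | C a =>
    rw [Dop_C, ← C_0, Ff_C, Ff_C]
    exact hasDerivAt_const y a
  | add p q hp hq =>
    rw [Dop_add, Ff_add, Ff_add]
    exact hp.add hq
  | mul_X p n hp =>
    have hn : HasDerivAt (iteratedDeriv n f) (iteratedDeriv (n + 1) f y) y := by
      rw [iteratedDeriv_succ]
      exact (hf.differentiable_iteratedDeriv n
        (by exact_mod_cast WithTop.coe_lt_top n) y).hasDerivAt
    rw [Dop_mul, Dop_X, Ff_add, Ff_mul, Ff_mul, Ff_mul, Ff_X, Ff_X]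
    exact hp.mul hn

/-- Compatibility of elementary differentials with the derivation `D` (chain rule):
`y ↦ F_f[p](y)` is `C^∞` and its derivative is `y ↦ F_f[D p](y)`. -/
theorem elementary_differential_chain_rule
    (f : ℝ → ℝ) (hf : ContDiff ℝ (⊤ : ℕ∞) f) (p : MvPolynomial ℕ ℝ) :
    ContDiff ℝ (⊤ : ℕ∞) (fun y => Ff f p y) ∧
    deriv (fun y => Ff f p y) = fun y => Ff f (Dop p) y :=
  ⟨contDiff_Ff hf p, funext fun y => (hasDerivAt_Ff hf p y).deriv⟩
end

section
/- The insertion product preserves populated multi-indices: for all populated multi-indices β and α, the insertion z^β ▶ z^α := ∑_{k ∈ ℕ} D^k(z^β) · ∂_{X_k}(z^α) (a finite sum, since ∂_{X_k}(z^α) = 0 for all but finitely many k) is a linear combination with natural-number coefficients of monomials z^γ with γ populated. -/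
open MvPolynomial

/-- Multi-indices: finitely supported functions `ℕ → ℕ`. -/
abbrev MI := ℕ →₀ ℕ

/-- The monomial `z^β = ∏_k X_k^{β k}` in `ℝ[X_0, X_1, …]`. -/
noncomputable def zm (β : MI) : MvPolynomial ℕ ℝ := monomial β 1

/-- `β` is populated if `∑_k (1 - k) β(k) = 1`. -/
def Populated (β : MI) : Prop := (β.sum fun k n => (1 - (k : ℤ)) * n) = 1

/-- The insertion product `z^β ▶ z^α = ∑_k D^k(z^β) · ∂_{X_k}(z^α)`. -/
noncomputable def ins (β α : MI) : MvPolynomial ℕ ℝ :=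
  ∑ᶠ k : ℕ, Dop^[k] (zm β) * pderiv k (zm α)

/-- The weight `[β] = ∑_k (1 - k) β(k)`. -/
def weight (β : MI) : ℤ := β.sum fun k n => (1 - (k : ℤ)) * n

theorem weight_add (β γ : MI) : weight (β + γ) = weight β + weight γ :=
  Finsupp.sum_add_index' (by simp) (by intros; push_cast; ring)

theorem weight_single_one (k : ℕ) : weight (Finsupp.single k 1) = 1 - k := by
  simp [weight]

/-- The linear combinations with `ℕ`-coefficients of monomials of weight `w`. -/
noncomputable def natSpan (w : ℤ) : AddSubmonoid (MvPolynomial ℕ ℝ) :=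
  AddSubmonoid.closure (zm '' {γ | weight γ = w})

theorem zm_mem_natSpan (γ : MI) : zm γ ∈ natSpan (weight γ) :=
  AddSubmonoid.subset_closure ⟨γ, rfl, rfl⟩

theorem X_mem_natSpan (k : ℕ) : (X k : MvPolynomial ℕ ℝ) ∈ natSpan (1 - k) := by
  rw [← weight_single_one]
  exact zm_mem_natSpan _

theorem mul_mem_natSpan {a b : ℤ} {p q : MvPolynomial ℕ ℝ} (hp : p ∈ natSpan a)
    (hq : q ∈ natSpan b) : p * q ∈ natSpan (a + b) := by
  induction hp using AddSubmonoid.closure_induction with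
  | mem x hx =>
    obtain ⟨β, rfl, rfl⟩ := hx
    induction hq using AddSubmonoid.closure_induction with
    | mem y hy =>
      obtain ⟨γ, rfl, rfl⟩ := hy
      rw [← weight_add, zm, zm, monomial_mul, one_mul]
      exact zm_mem_natSpan _
    | zero => simp
    | add y z _ _ hy hz =>
      rw [mul_add]
      exact add_mem hy hz
  | zero => simp
  | add x y _ _ hx hy =>
    rw [add_mul]
    exact add_mem hx hy

theorem pderiv_mem_natSpan {w : ℤ} {p : MvPolynomial ℕ ℝ} (k : ℕ) (hp : p ∈ natSpan w) :
    pderiv k p ∈ natSpan (w - (1 - k)) := by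
  induction hp using AddSubmonoid.closure_induction with
  | mem x hx =>
    obtain ⟨γ, rfl, rfl⟩ := hx
    rw [zm, pderiv_monomial, one_mul]
    rcases Nat.eq_zero_or_pos (γ k) with h | h
    · simp [h]
    · have hγ : γ - Finsupp.single k 1 + Finsupp.single k 1 = γ :=
        tsub_add_cancel_of_le (Finsupp.single_le_iff.2 h)
      have hw : weight γ - (1 - k) = weight (γ - Finsupp.single k 1) := by
        conv_lhs => rw [← hγ, weight_add, weight_single_one]
        ring
      have hm : monomial (γ - Finsupp.single k 1) (γ k : ℝ) =
          γ k • zm (γ - Finsupp.single k 1) := by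
        rw [zm, ← map_nsmul, nsmul_one]
      rw [hw, hm]
      exact nsmul_mem (zm_mem_natSpan _) _
  | zero => simp
  | add x y _ _ hx hy =>
    rw [map_add]
    exact add_mem hx hy

theorem finsum_mem_natSpan {w : ℤ} {f : ℕ → MvPolynomial ℕ ℝ} (hf : ∀ k, f k ∈ natSpan w) :
    ∑ᶠ k, f k ∈ natSpan w :=
  finsum_induction (· ∈ natSpan w) (zero_mem _) (fun _ _ => add_mem) hf

theorem Dop_mem_natSpan {w : ℤ} {p : MvPolynomial ℕ ℝ} (hp : p ∈ natSpan w) :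
    Dop p ∈ natSpan (w - 1) := by
  refine finsum_mem_natSpan fun k => ?_
  have h := mul_mem_natSpan (X_mem_natSpan (k + 1)) (pderiv_mem_natSpan k hp)
  have hw : (1 - ((k + 1 : ℕ) : ℤ)) + (w - (1 - k)) = w - 1 := by
    push_cast
    ring
  rwa [hw] at h

theorem Dop_iterate_mem_natSpan {w : ℤ} {p : MvPolynomial ℕ ℝ} (k : ℕ) (hp : p ∈ natSpan w) :
    Dop^[k] p ∈ natSpan (w - k) := by
  induction k with
  | zero => simpa using hp
  | succ k ih =>
    rw [Function.iterate_succ_apply', Nat.cast_succ, ← sub_sub]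
    exact Dop_mem_natSpan ih

theorem ins_mem_natSpan (β α : MI) :
    ins β α ∈ natSpan (weight β + weight α - 1) := by
  refine finsum_mem_natSpan fun k => ?_
  have h := mul_mem_natSpan (Dop_iterate_mem_natSpan k (zm_mem_natSpan β))
    (pderiv_mem_natSpan k (zm_mem_natSpan α))
  have hw : weight β - k + (weight α - (1 - k)) = weight β + weight α - 1 := by ring
  rwa [hw] at h

theorem exists_finsupp_of_mem_natSpan {w : ℤ} {p : MvPolynomial ℕ ℝ} (hp : p ∈ natSpan w) :
    ∃ c : MI →₀ ℕ, (∀ γ ∈ c.support, weight γ = w) ∧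
      p = c.sum fun γ n => (n : ℝ) • zm γ := by
  classical
  induction hp using AddSubmonoid.closure_induction with
  | mem x hx =>
    obtain ⟨γ, hγ, rfl⟩ := hx
    refine ⟨Finsupp.single γ 1, fun δ hδ => ?_, by simp⟩
    rwa [Finset.mem_singleton.1 (Finsupp.support_single_subset hδ)]
  | zero => exact ⟨0, by simp, by simp⟩
  | add x y _ _ hx hy =>
    obtain ⟨c, hc, rfl⟩ := hx
    obtain ⟨d, hd, rfl⟩ := hy
    refine ⟨c + d, fun γ hγ => ?_, ?_⟩
    · exact (Finset.mem_union.1 (Finsupp.support_add hγ)).elim (hc γ) (hd γ)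
    · rw [Finsupp.sum_add_index' (by simp) (by simp [add_smul])]

/-- The insertion product preserves populated multi-indices: for populated `β, α`,
`z^β ▶ z^α` is a linear combination with ℕ-coefficients of populated monomials. -/
theorem insertion_preserves_populated (β α : MI) (hβ : Populated β) (hα : Populated α) :
    ∃ c : MI →₀ ℕ, (∀ γ ∈ c.support, Populated γ) ∧
      ins β α = c.sum fun γ n => (n : ℝ) • zm γ := by
  have h := ins_mem_natSpan β α
  rw [show weight β = 1 from hβ, show weight α = 1 from hα] at h
  exact exists_finsupp_of_mem_natSpan h
end
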